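/- arXiv:2507.06030 — 2 statements merged into one kernel-verified Lean document; each statement's English description precedes it below -/
import Mathlib

section
/- Nonclassicality witness for classical (Poisson-mixture) photon statistics: let μ be a probability measure on [0,∞) with finite first moment, and define p_n := ∫ e^{−λ}·λⁿ/n! dμ(λ) for n ∈ ℕ. Then for every r ∈ [0,1], C_r(p) ≤ (1−r)·M(p) + r, where M(p) = ∫ λ dμ(λ). -/
open MeasureTheory

/-- The Fisher difference `f(x,y) = (x-y)^2/(x+y)`, with `f(0,0) = 0`
(automatic since division by zero is zero in Lean). -/
noncomputable def fisherDiff (x y : ℝ) : ℝ := (x - y) ^ 2 / (x + y)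

/-- The latent coherence `C_r(p) = ∑_{n≥1} f(p_n, r p_{n-1}) n`. -/
noncomputable def latentCoh (r : ℝ) (p : ℕ → ℝ) : ℝ :=
  ∑' n : ℕ, fisherDiff (p (n + 1)) (r * p n) * (n + 1 : ℝ)

lemma hasSum_poisson_weights (x : ℝ) :
    HasSum (fun n : ℕ => Real.exp (-x) * x ^ n / (Nat.factorial n)) 1 := by
  have h : HasSum (fun n : ℕ => x ^ n / (Nat.factorial n : ℝ)) (Real.exp x) := by
    rw [Real.exp_eq_exp_ℝ]
    exact NormedSpace.expSeries_div_hasSum_exp x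
  simpa [mul_div_assoc, ← Real.exp_add] using h.mul_left (Real.exp (-x))

lemma poisson_weight_nonneg {x : ℝ} (hx : 0 ≤ x) (n : ℕ) :
    0 ≤ Real.exp (-x) * x ^ n / (Nat.factorial n) := by
  positivity

section PoissonMixture

variable {μ : Measure ℝ}

lemma hasSum_integral_mul_poisson (hpos : ∀ᵐ x ∂μ, 0 ≤ x) {g : ℝ → ℝ}
    (hg : Integrable g μ) (hg0 : ∀ᵐ x ∂μ, 0 ≤ g x) :
    HasSum (fun n : ℕ => ∫ x, g x * (Real.exp (-x) * x ^ n / (Nat.factorial n)) ∂μ)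
      (∫ x, g x ∂μ) := by
  have hsum (x : ℝ) :
      HasSum (fun n : ℕ => g x * (Real.exp (-x) * x ^ n / (Nat.factorial n))) (g x) := by
    simpa using (hasSum_poisson_weights x).mul_left (g x)
  refine hasSum_integral_of_dominated_convergence
    (fun n x => g x * (Real.exp (-x) * x ^ n / (Nat.factorial n))) (fun n => ?_) (fun n => ?_)
    (.of_forall fun x => (hsum x).summable) ?_ (.of_forall hsum)
  · exact hg.aestronglyMeasurable.mul
      (by fun_prop : Measurable fun x : ℝ =>
        Real.exp (-x) * x ^ n / (Nat.factorial n)).aestronglyMeasurable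
  · filter_upwards [hpos, hg0] with x hx hgx
    rw [Real.norm_of_nonneg (mul_nonneg hgx (poisson_weight_nonneg hx n))]
  · simpa only [(hsum _).tsum_eq] using hg

lemma integrable_exp_neg_mul_pow [IsFiniteMeasure μ] (hpos : ∀ᵐ x ∂μ, 0 ≤ x) (n : ℕ) :
    Integrable (fun x => Real.exp (-x) * x ^ n) μ := by
  refine Integrable.of_bound (by fun_prop) (Nat.factorial n : ℝ) ?_
  filter_upwards [hpos] with x hx
  rw [Real.norm_of_nonneg (by positivity)]
  have h := le_hasSum (hasSum_poisson_weights x) n fun k _ => poisson_weight_nonneg hx k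
  rwa [div_le_one (by positivity)] at h

lemma integral_exp_neg_mul_pow_sq_le [IsFiniteMeasure μ] (hpos : ∀ᵐ x ∂μ, 0 ≤ x) (n : ℕ) :
    (∫ x, Real.exp (-x) * x ^ (n + 1) ∂μ) ^ 2 ≤
      (∫ x, Real.exp (-x) * x ^ (n + 2) ∂μ) * ∫ x, Real.exp (-x) * x ^ n ∂μ := by
  have h0 := integrable_exp_neg_mul_pow hpos n
  have h1 := integrable_exp_neg_mul_pow hpos (n + 1)
  have h2 := integrable_exp_neg_mul_pow hpos (n + 2)
  have h := discrim_le_zero (a := ∫ x, Real.exp (-x) * x ^ (n + 2) ∂μ)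
    (b := 2 * ∫ x, Real.exp (-x) * x ^ (n + 1) ∂μ) (c := ∫ x, Real.exp (-x) * x ^ n ∂μ) fun t => by
      have hq : 0 ≤ ∫ x, (t * t) * (Real.exp (-x) * x ^ (n + 2)) +
          (2 * t) * (Real.exp (-x) * x ^ (n + 1)) + Real.exp (-x) * x ^ n ∂μ := by
        refine integral_nonneg_of_ae ?_
        filter_upwards [hpos] with x hx
        have : 0 ≤ Real.exp (-x) * x ^ n * (t * x + 1) ^ 2 := by positivity
        simp only [Pi.zero_apply]
        linarith [this, show Real.exp (-x) * x ^ n * (t * x + 1) ^ 2 =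
          (t * t) * (Real.exp (-x) * x ^ (n + 2)) +
            (2 * t) * (Real.exp (-x) * x ^ (n + 1)) + Real.exp (-x) * x ^ n by ring]
      rw [integral_add (f := fun x => (t * t) * (Real.exp (-x) * x ^ (n + 2)) +
          (2 * t) * (Real.exp (-x) * x ^ (n + 1))) ((h2.const_mul _).add (h1.const_mul _)) h0,
        integral_add (h2.const_mul _) (h1.const_mul _), integral_const_mul,
        integral_const_mul] at hq
      linarith
  rw [discrim] at h
  linarith

end PoissonMixture

lemma fisherDiff_nonneg {x y : ℝ} (hx : 0 ≤ x) (hy : 0 ≤ y) : 0 ≤ fisherDiff x y := by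
  unfold fisherDiff
  positivity

lemma fisherDiff_mul_le {r x y z c : ℝ} (hr0 : 0 ≤ r) (hr1 : r ≤ 1) (hx : 0 ≤ x) (hy : 0 ≤ y)
    (hz : 0 ≤ z) (hc : 0 ≤ c) (h : c * x ^ 2 ≤ z * y) (hxy : y = 0 → x = 0) :
    fisherDiff x (r * y) * c ≤ c * x + r * (c * y) - r * (3 * (c * x) - z) := by
  unfold fisherDiff
  rcases hy.eq_or_lt with rfl | hy
  · simp [hxy rfl]
    positivity
  rcases hx.eq_or_lt with rfl | hx
  · rcases hr0.eq_or_lt with rfl | hr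
    · simp
    · have : (0 - r * y) ^ 2 / (0 + r * y) * c = r * (c * y) := by
        field_simp
        ring
      rw [this]
      nlinarith [mul_nonneg hr0 hz]
  · have hz' : c * x ^ 2 / y ≤ z := by rwa [div_le_iff₀ hy]
    have hs : 0 < x + r * y := by positivity
    have e : (x - r * y) ^ 2 / (x + r * y) * c =
        c * x + r * (c * y) - r * (4 * (c * x * y / (x + r * y))) := by
      field_simp
      ring
    have h1 : c * x * y / (x + y) ≤ c * x * y / (x + r * y) :=
      div_le_div_of_nonneg_left (by positivity) hs (by nlinarith)
    have h2 : 4 * (c * x * y / (x + y)) - (3 * (c * x) - c * x ^ 2 / y) =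
        c * x * (x - y) ^ 2 / (y * (x + y)) := by
      field_simp
      ring
    have h3 : 0 ≤ c * x * (x - y) ^ 2 / (y * (x + y)) := by positivity
    rw [e]
    have : r * (3 * (c * x) - z) ≤ r * (4 * (c * x * y / (x + r * y))) :=
      mul_le_mul_of_nonneg_left (by linarith) hr0
    linarith

/-- For the counting statistics of a Poisson mixture, `n p_n² ≤ (n+1) p_{n+1} p_{n-1}` is the only
information needed beyond the values of the total mass and of the mean. -/
lemma latentCoh_le_of_log_convex {p : ℕ → ℝ} {M r : ℝ} (hr0 : 0 ≤ r) (hr1 : r ≤ 1)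
    (hp : ∀ n, 0 ≤ p n) (hp1 : HasSum p 1) (hM : HasSum (fun n : ℕ => (n + 1 : ℝ) * p (n + 1)) M)
    (hlc : ∀ n : ℕ, (n + 1 : ℝ) * p (n + 1) ^ 2 ≤ (n + 2 : ℝ) * p (n + 2) * p n) :
    latentCoh r p ≤ (1 - r) * M + r := by
  have hM0 : HasSum (fun n : ℕ => (n : ℝ) * p n) M := by
    rw [← hasSum_nat_add_iff' 1]
    simpa using hM
  have hy : HasSum (fun n : ℕ => (n + 1 : ℝ) * p n) (M + 1) := by
    simpa [add_mul] using hM0.add hp1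
  have hz : HasSum (fun n : ℕ => (n + 2 : ℝ) * p (n + 2)) (M - p 1) := by
    have := (hasSum_nat_add_iff' 2).2 hM0
    simpa [Finset.sum_range_succ] using this
  have hB := (hM.add (hy.mul_left r)).sub (((hM.mul_left 3).sub hz).mul_left r)
  have hle (n : ℕ) := fisherDiff_mul_le hr0 hr1 (hp (n + 1)) (hp n)
    (mul_nonneg (by positivity : (0 : ℝ) ≤ n + 2) (hp (n + 2))) (by positivity : (0 : ℝ) ≤ n + 1)
    (hlc n) fun h => by
      have hn := hlc n
      rw [h, mul_zero] at hn
      have hn1 : (0 : ℝ) < n + 1 := by positivity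
      exact pow_eq_zero_iff two_ne_zero |>.1 (le_antisymm (by nlinarith) (sq_nonneg _))
  have hs : Summable fun n : ℕ => fisherDiff (p (n + 1)) (r * p n) * (n + 1 : ℝ) :=
    .of_nonneg_of_le (fun n => mul_nonneg
      (fisherDiff_nonneg (hp _) (mul_nonneg hr0 (hp _))) (by positivity)) hle hB.summable
  have := hasSum_le hle hs.hasSum hB
  unfold latentCoh
  nlinarith [mul_nonneg hr0 (hp 1)]

/-- Nonclassicality witness: a Poisson mixture (classical state) has latent
coherence at most `(1-r)·M + r`, where `M = ∫ λ dμ` is the mean photon number. -/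
theorem latentCoh_le_of_classical (μ : Measure ℝ) [IsProbabilityMeasure μ]
    (hpos : ∀ᵐ x ∂μ, 0 ≤ x) (hmom : Integrable (fun x => x) μ)
    (r : ℝ) (hr0 : 0 ≤ r) (hr1 : r ≤ 1) :
    latentCoh r (fun n => ∫ x, Real.exp (-x) * x ^ n / (Nat.factorial n) ∂μ) ≤
      (1 - r) * (∫ x, x ∂μ) + r := by
  refine latentCoh_le_of_log_convex hr0 hr1 (fun n => ?_) ?_ ?_ fun n => ?_
  · refine integral_nonneg_of_ae ?_
    filter_upwards [hpos] with x hx using poisson_weight_nonneg hx n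
  · simpa using hasSum_integral_mul_poisson hpos (integrable_const (1 : ℝ)) (by simp)
  · convert hasSum_integral_mul_poisson hpos hmom hpos using 2 with n
    rw [← integral_const_mul]
    congr 1 with x
    rw [Nat.factorial_succ]
    push_cast
    field_simp
    ring
  · have h := integral_exp_neg_mul_pow_sq_le hpos n
    simp only [integral_div, Nat.factorial_succ]
    push_cast
    have hn : (0 : ℝ) < Nat.factorial n := by positivity
    have e1 : ∀ m : ℝ, (n + 1 : ℝ) * (m / ((n + 1) * Nat.factorial n)) ^ 2 =
        m ^ 2 / ((n + 1) * (Nat.factorial n : ℝ) ^ 2) := fun m => by field_simp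
    have e2 : ∀ a b : ℝ, (n + 2 : ℝ) * (a / ((n + 1 + 1) * ((n + 1) * Nat.factorial n))) *
        (b / Nat.factorial n) = a * b / ((n + 1) * (Nat.factorial n : ℝ) ^ 2) := fun a b => by
      rw [show (n + 1 + 1 : ℝ) = n + 2 by ring]
      field_simp
    rw [e1, e2]
    gcongr
end

section
/- Factorization of the two-mode Fisher-difference sum with k-photon exchange: let 0 < r < 1, let g_m := (1−r)·r^m, let k ≥ 1, and let p be a probability distribution on ℕ with finite k-th factorial moment ∑_n p_n·n_(k). Then ∑_{n≥k, m≥0} f(p_n·g_m, p_{n−k}·g_{m+k}) · n_(k) · (m+1)^{(k)} = (k!/(1−r)^k) · ∑_{n≥k} f(p_n, r^k·p_{n−k}) · n_(k), where n_(k) = n(n−1)⋯(n−k+1) is the falling factorial and (m+1)^{(k)} = (m+1)(m+2)⋯(m+k) is the rising factorial. -/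
theorem fisherDiff_mul_mul (c x y : ℝ) :
    fisherDiff (x * c) (y * c) = fisherDiff x y * c := by
  unfold fisherDiff
  rcases eq_or_ne c 0 with rfl | hc
  · simp
  · rw [← sub_mul, ← add_mul, mul_pow, pow_two c, ← mul_assoc,
      mul_div_mul_right _ _ hc, mul_div_right_comm]

theorem hasSum_ascFactorial_mul_geometric {r : ℝ} (hr0 : 0 < r) (hr1 : r < 1) (k : ℕ) :
    HasSum (fun m : ℕ => (1 - r) * r ^ m * (Nat.ascFactorial (m + 1) k : ℝ))
      ((Nat.factorial k : ℝ) / (1 - r) ^ k) := by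
  have hr : ‖r‖ < 1 := by rwa [Real.norm_of_nonneg hr0.le]
  have h1r : 1 - r ≠ 0 := (sub_pos.2 hr1).ne'
  convert! (hasSum_choose_mul_geometric_of_norm_lt_one k hr).mul_left
    ((1 - r) * (Nat.factorial k : ℝ)) using 1
  · funext m
    rw [Nat.ascFactorial_eq_factorial_mul_choose]
    push_cast
    ring
  · field_simp
    rw [pow_succ']

/-- No summability of `a` is needed: if `a` is not summable, then both sides vanish. -/
theorem tsum_prod_mul_of_hasSum {α β : Type*} {a : α → ℝ} {b : β → ℝ} {s : ℝ}
    (hb : HasSum b s) {j : β} (hj : b j ≠ 0) :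
    ∑' x : α × β, a x.1 * b x.2 = s * ∑' i, a i := by
  by_cases ha : Summable a
  · rw [← hb.tsum_eq, mul_comm]
    exact (tsum_mul_tsum_of_summable_norm ha.norm hb.summable.norm).symm
  · rw [tsum_eq_zero_of_not_summable ha, mul_zero]
    refine tsum_eq_zero_of_not_summable fun h => ha ?_
    exact (summable_mul_right_iff hj).1
      (h.comp_injective (i := fun i : α => (i, j)) fun _ _ hij => congrArg Prod.fst hij)

/-- Factorization of the two-mode Fisher-difference sum with `k`-photon exchange.
Here `Nat.descFactorial n k = n(n−1)⋯(n−k+1)` is the falling factorial and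
`Nat.ascFactorial (m+1) k = (m+1)(m+2)⋯(m+k)` is the rising factorial. -/
theorem two_mode_fisher_sum_factorization_k (r : ℝ) (hr0 : 0 < r) (hr1 : r < 1)
    (k : ℕ) (hk : 1 ≤ k)
    (p : ℕ → ℝ) (hp : ∀ n, 0 ≤ p n) (hp1 : ∑' n : ℕ, p n = 1)
    (hmom : Summable fun n : ℕ => p n * (Nat.descFactorial n k : ℝ)) :
    (∑' nm : ℕ × ℕ,
        fisherDiff (p (nm.1 + k) * ((1 - r) * r ^ nm.2))
            (p nm.1 * ((1 - r) * r ^ (nm.2 + k))) *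
          (Nat.descFactorial (nm.1 + k) k : ℝ) *
          (Nat.ascFactorial (nm.2 + 1) k : ℝ)) =
      ((Nat.factorial k : ℝ) / (1 - r) ^ k) *
        ∑' n : ℕ,
          fisherDiff (p (n + k)) (r ^ k * p n) * (Nat.descFactorial (n + k) k : ℝ) := by
  have h0 : (1 - r) * r ^ 0 * (Nat.ascFactorial (0 + 1) k : ℝ) ≠ 0 := by
    have : (Nat.ascFactorial (0 + 1) k : ℝ) ≠ 0 := by
      exact_mod_cast (Nat.ascFactorial_pos 0 k).ne'
    exact mul_ne_zero (by simpa using (sub_pos.2 hr1).ne') this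
  rw [← tsum_prod_mul_of_hasSum (hasSum_ascFactorial_mul_geometric hr0 hr1 k) h0]
  refine tsum_congr fun nm => ?_
  have h : p nm.1 * ((1 - r) * r ^ (nm.2 + k)) = r ^ k * p nm.1 * ((1 - r) * r ^ nm.2) := by
    ring
  rw [h, fisherDiff_mul_mul]
  ring
end
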